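/- Let E be a complete lattice effect algebra and {x_α : α ∈ A} a family of bounded observables with a bounded upper bound y in the Olson order. Then the system x(t) := ⋁_{u<t} ⋀_α x_α((-∞,u)) is a spectral resolution determining a unique bounded observable x which is the least upper bound of {x_α} in the Olson order. -/

import Mathlib

structure EffectAlgebra (E : Type*) where
  add : E → E → Option E
  zero : E
  one : E
  comm : ∀ a b, add a b = add b a
  assoc : ∀ a b c, (add a b).bind (fun d => add d c) = (add b c).bind (fun d => add a d)
  orth : ∀ a : E, ∃! b, add a b = some one
  pos_one : ∀ a b, add a one = some b → a = zero

namespace EffectAlgebra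

variable {E : Type*}

/-- The induced order: `a ≤ b` iff `a + c = b` for some `c`. -/
def le (EA : EffectAlgebra E) (a b : E) : Prop := ∃ c, EA.add a c = some b

/-- The orthosupplement `a'`, the unique element with `a + a' = 1`. -/
noncomputable def orthosupp (EA : EffectAlgebra E) (a : E) : E :=
  Classical.choose (EA.orth a).exists

/-- `s` is the supremum of `S` with respect to the induced order. -/
def IsSup (EA : EffectAlgebra E) (S : Set E) (s : E) : Prop :=
  (∀ x ∈ S, EA.le x s) ∧ ∀ b, (∀ x ∈ S, EA.le x b) → EA.le s b

/-- `s` is the infimum of `S` with respect to the induced order. -/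
def IsInf (EA : EffectAlgebra E) (S : Set E) (s : E) : Prop :=
  (∀ x ∈ S, EA.le s x) ∧ ∀ b, (∀ x ∈ S, EA.le b x) → EA.le b s

/-- Every increasing sequence has a supremum. -/
def MonotoneSigmaComplete (EA : EffectAlgebra E) : Prop :=
  ∀ f : ℕ → E, (∀ n, EA.le (f n) (f (n + 1))) → ∃ s, EA.IsSup (Set.range f) s

/-- A σ-lattice effect algebra: countable suprema and infima exist. -/
def SigmaLattice (EA : EffectAlgebra E) : Prop :=
  (∀ f : ℕ → E, ∃ s, EA.IsSup (Set.range f) s) ∧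
  (∀ f : ℕ → E, ∃ s, EA.IsInf (Set.range f) s)

/-- A complete lattice effect algebra: arbitrary suprema and infima exist. -/
def CompleteEA (EA : EffectAlgebra E) : Prop :=
  (∀ S : Set E, ∃ s, EA.IsSup S s) ∧ (∀ S : Set E, ∃ s, EA.IsInf S s)

/-- A lattice effect algebra: binary suprema and infima exist. -/
def LatticeEA (EA : EffectAlgebra E) : Prop :=
  (∀ a b : E, ∃ s, EA.IsSup {a, b} s) ∧ (∀ a b : E, ∃ s, EA.IsInf {a, b} s)

end EffectAlgebra

/-- Borel subsets of the real line. -/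
abbrev BorelSet := {A : Set ℝ // MeasurableSet A}

def bIio (t : ℝ) : BorelSet := ⟨Set.Iio t, measurableSet_Iio⟩
def bIic (t : ℝ) : BorelSet := ⟨Set.Iic t, measurableSet_Iic⟩

/-- An observable on a (monotone σ-complete) effect algebra: a unital,
additive map on the Borel σ-algebra preserving suprema of increasing sequences. -/
structure Observable {E : Type*} (EA : EffectAlgebra E) where
  toFun : BorelSet → E
  unital : toFun ⟨Set.univ, MeasurableSet.univ⟩ = EA.one
  additive : ∀ A B : BorelSet, Disjoint A.1 B.1 →
    EA.add (toFun A) (toFun B) = some (toFun ⟨A.1 ∪ B.1, A.2.union B.2⟩)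
  sup_cont : ∀ f : ℕ → BorelSet, (∀ n, (f n).1 ⊆ (f (n + 1)).1) →
    EA.IsSup (Set.range fun n => toFun (f n))
      (toFun ⟨⋃ n, (f n).1, MeasurableSet.iUnion (fun n => (f n).2)⟩)

namespace Observable

variable {E : Type*} {EA : EffectAlgebra E}

/-- The Olson (spectral) order on observables. -/
def OlsonLe (x y : Observable EA) : Prop :=
  ∀ t : ℝ, EA.le (y.toFun (bIio t)) (x.toFun (bIio t))

/-- An observable is bounded if `x(C) = 1` for some compact set `C`. -/
def Bounded (x : Observable EA) : Prop :=
  ∃ C : Set ℝ, ∃ hC : IsCompact C, x.toFun ⟨C, hC.measurableSet⟩ = EA.one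

/-- `x` is the question observable `q_a` of the element `a`. -/
def IsQuestion (x : Observable EA) (a : E) : Prop :=
  ∀ t : ℝ, x.toFun (bIio t) =
    if t ≤ 0 then EA.zero else if t ≤ 1 then EA.orthosupp a else EA.one

/-- The spectrum of `x` lies in `[0,1]`. -/
def SpectrumIn01 (x : Observable EA) : Prop :=
  x.toFun ⟨Set.Icc 0 1, measurableSet_Icc⟩ = EA.one

/-- `z` is the infimum of `S` in the Olson order on bounded observables. -/
def IsOlsonInf (S : Set (Observable EA)) (z : Observable EA) : Prop :=
  z.Bounded ∧ (∀ x ∈ S, z.OlsonLe x) ∧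
    ∀ w : Observable EA, w.Bounded → (∀ x ∈ S, w.OlsonLe x) → w.OlsonLe z

/-- `z` is the supremum of `S` in the Olson order on bounded observables. -/
def IsOlsonSup (S : Set (Observable EA)) (z : Observable EA) : Prop :=
  z.Bounded ∧ (∀ x ∈ S, x.OlsonLe z) ∧
    ∀ w : Observable EA, w.Bounded → (∀ x ∈ S, x.OlsonLe w) → z.OlsonLe w

end Observable

/-- A spectral resolution: monotone, with infimum 0, supremum 1, left continuous. -/
def SpectralResolution {E : Type*} (EA : EffectAlgebra E) (F : ℝ → E) : Prop :=
  (∀ t s : ℝ, t < s → EA.le (F t) (F s)) ∧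
  EA.IsInf (Set.range F) EA.zero ∧
  EA.IsSup (Set.range F) EA.one ∧
  ∀ s : ℝ, EA.IsSup (F '' Set.Iio s) (F s)

namespace EffectAlgebra

variable {E : Type*} {EA : EffectAlgebra E} {a b c d e : E}

theorem add_symm (h : EA.add a b = some c) : EA.add b a = some c := by
  rw [EA.comm, h]

theorem add_assoc_right (h₁ : EA.add a b = some d) (h₂ : EA.add d c = some e) :
    ∃ f, EA.add b c = some f ∧ EA.add a f = some e := by
  have h := EA.assoc a b c
  rw [h₁, Option.bind_some, h₂] at h
  exact Option.bind_eq_some_iff.mp h.symm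

theorem add_assoc_left (h₁ : EA.add b c = some d) (h₂ : EA.add a d = some e) :
    ∃ f, EA.add a b = some f ∧ EA.add f c = some e := by
  have h := EA.assoc a b c
  rw [h₁, Option.bind_some, h₂] at h
  exact Option.bind_eq_some_iff.mp h

theorem add_orthosupp (EA : EffectAlgebra E) (a : E) :
    EA.add a (EA.orthosupp a) = some EA.one :=
  Classical.choose_spec (EA.orth a).exists

theorem eq_orthosupp (h : EA.add a b = some EA.one) : b = EA.orthosupp a :=
  (EA.orth a).unique h (EA.add_orthosupp a)

theorem orthosupp_orthosupp (EA : EffectAlgebra E) (a : E) :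
    EA.orthosupp (EA.orthosupp a) = a :=
  (eq_orthosupp (add_symm (EA.add_orthosupp a))).symm

theorem add_left_cancel (h₁ : EA.add a b = some d) (h₂ : EA.add a c = some d) : b = c := by
  have key : ∀ {x}, EA.add a x = some d →
      ∃ f, EA.add a (EA.orthosupp d) = some f ∧ EA.add f x = some EA.one := by
    intro x hx
    obtain ⟨f, hf, hf'⟩ := add_assoc_right hx (EA.add_orthosupp d)
    exact add_assoc_left (add_symm hf) hf'
  obtain ⟨f, hf, hf'⟩ := key h₁
  obtain ⟨g, hg, hg'⟩ := key h₂
  obtain rfl : f = g := Option.some.inj (hf.symm.trans hg)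
  rw [eq_orthosupp hf', eq_orthosupp hg']

theorem orthosupp_one (EA : EffectAlgebra E) : EA.orthosupp EA.one = EA.zero :=
  EA.pos_one _ _ (add_symm (EA.add_orthosupp EA.one))

theorem add_zero (EA : EffectAlgebra E) (a : E) : EA.add a EA.zero = some a := by
  have h := EA.add_orthosupp EA.one
  rw [orthosupp_one] at h
  obtain ⟨f, hf, hf'⟩ := add_assoc_right (add_symm (EA.add_orthosupp a)) h
  rw [hf, eq_orthosupp hf', orthosupp_orthosupp]

theorem eq_zero_of_add_eq_zero (h : EA.add a b = some EA.zero) : b = EA.zero := by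
  obtain ⟨f, hf, -⟩ := add_assoc_right h (add_symm (EA.add_zero EA.one))
  exact EA.pos_one _ _ hf

theorem le_refl (EA : EffectAlgebra E) (a : E) : EA.le a a := ⟨_, EA.add_zero a⟩

theorem le_trans (h₁ : EA.le a b) (h₂ : EA.le b c) : EA.le a c := by
  obtain ⟨x, hx⟩ := h₁
  obtain ⟨y, hy⟩ := h₂
  obtain ⟨f, -, hf⟩ := add_assoc_right hx hy
  exact ⟨f, hf⟩

theorem le_antisymm (h₁ : EA.le a b) (h₂ : EA.le b a) : a = b := by
  obtain ⟨x, hx⟩ := h₁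
  obtain ⟨y, hy⟩ := h₂
  obtain ⟨f, hf, hf'⟩ := add_assoc_right hx hy
  obtain rfl := add_left_cancel hf' (EA.add_zero a)
  obtain rfl := eq_zero_of_add_eq_zero (add_symm hf)
  exact Option.some.inj ((EA.add_zero a).symm.trans hx)

/-- The complete lattice underlying a complete lattice effect algebra. -/
noncomputable abbrev completeLattice (EA : EffectAlgebra E) (hE : EA.CompleteEA) :
    CompleteLattice E :=
  letI : PartialOrder E :=
    { le := EA.le
      le_refl := EA.le_refl
      le_trans := fun _ _ _ => le_trans
      le_antisymm := fun _ _ => le_antisymm }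
  letI : SupSet E := ⟨fun S => Classical.choose (hE.1 S)⟩
  completeLatticeOfSup E fun S => Classical.choose_spec (hE.1 S)

/-- The ambient order is the one induced by the effect algebra. -/
class InducesOrder (EA : EffectAlgebra E) [LE E] : Prop where
  le_iff : ∀ {a b : E}, a ≤ b ↔ EA.le a b

variable [CompleteLattice E] [EA.InducesOrder]

theorem isSup_iff_isLUB {S : Set E} : EA.IsSup S a ↔ IsLUB S a := by
  simp only [IsSup, IsLUB, IsLeast, upperBounds, lowerBounds, ← InducesOrder.le_iff,
    Set.mem_ofPred_eq]

theorem isInf_iff_isGLB {S : Set E} : EA.IsInf S a ↔ IsGLB S a := by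
  simp only [IsInf, IsGLB, IsGreatest, upperBounds, lowerBounds, ← InducesOrder.le_iff,
    Set.mem_ofPred_eq]

theorem exists_add_of_le (EA : EffectAlgebra E) [EA.InducesOrder] (h : a ≤ b) :
    ∃ c, EA.add a c = some b :=
  InducesOrder.le_iff.mp h

theorem left_le (h : EA.add a b = some c) : a ≤ c := (InducesOrder.le_iff (EA := EA)).mpr ⟨b, h⟩

theorem right_le (h : EA.add a b = some c) : b ≤ c := left_le (add_symm h)

theorem zero_eq_bot (EA : EffectAlgebra E) [EA.InducesOrder] : EA.zero = ⊥ :=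
  le_bot_iff.mp (right_le (EA.add_zero ⊥))

theorem one_eq_top (EA : EffectAlgebra E) [EA.InducesOrder] : EA.one = ⊤ := by
  obtain ⟨c, hc⟩ := EA.exists_add_of_le (le_top (a := EA.one))
  rw [EA.pos_one _ _ (add_symm hc), add_zero] at hc
  exact Option.some.inj hc

theorem add_bot (EA : EffectAlgebra E) [EA.InducesOrder] (a : E) : EA.add a ⊥ = some a := by
  rw [← EA.zero_eq_bot, add_zero]

theorem add_le_iff (h₁ : EA.add a b = some d) (h₂ : EA.add a c = some e) : d ≤ e ↔ b ≤ c := by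
  constructor
  · intro h
    obtain ⟨x, hx⟩ := EA.exists_add_of_le h
    obtain ⟨f, hf, hf'⟩ := add_assoc_right h₁ hx
    obtain rfl := add_left_cancel hf' h₂
    exact left_le hf
  · intro h
    obtain ⟨x, hx⟩ := EA.exists_add_of_le h
    obtain ⟨f, hf, hf'⟩ := add_assoc_left hx h₂
    obtain rfl := Option.some.inj (h₁.symm.trans hf)
    exact left_le hf'

theorem exists_add_iff : (∃ c, EA.add a b = some c) ↔ b ≤ EA.orthosupp a := by
  constructor
  · rintro ⟨c, hc⟩
    obtain ⟨f, hf, hf'⟩ := add_assoc_right hc (EA.add_orthosupp c)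
    rw [← eq_orthosupp hf']
    exact left_le hf
  · intro h
    obtain ⟨x, hx⟩ := EA.exists_add_of_le h
    obtain ⟨f, hf, -⟩ := add_assoc_left hx (EA.add_orthosupp a)
    exact ⟨f, hf⟩

theorem le_orthosupp_comm : a ≤ EA.orthosupp b ↔ b ≤ EA.orthosupp a := by
  rw [← exists_add_iff, ← exists_add_iff, EA.comm]

theorem orthosupp_sup : EA.orthosupp (a ⊔ b) = EA.orthosupp a ⊓ EA.orthosupp b :=
  eq_of_forall_le_iff fun x => by
    rw [le_orthosupp_comm, sup_le_iff, le_inf_iff, le_orthosupp_comm, le_orthosupp_comm (a := b)]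

theorem add_mono {a' b' : E} (h : EA.add a b = some c) (ha : a' ≤ a) (hb : b' ≤ b) :
    ∃ c' ≤ c, EA.add a' b' = some c' := by
  have h1 := hb.trans (exists_add_iff.mp ⟨c, h⟩)
  obtain ⟨x, hx⟩ := exists_add_iff.mpr h1
  have h2 := ha.trans (exists_add_iff.mp ⟨x, add_symm hx⟩)
  obtain ⟨y, hy⟩ := exists_add_iff.mpr h2
  exact ⟨y, ((add_le_iff hy (add_symm hx)).mpr ha).trans ((add_le_iff hx h).mpr hb), add_symm hy⟩

theorem add_sup (h₁ : EA.add a b = some d) (h₂ : EA.add a c = some e) :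
    EA.add a (b ⊔ c) = some (d ⊔ e) := by
  obtain ⟨w, hw⟩ := exists_add_iff.mpr
    (sup_le (exists_add_iff.mp ⟨d, h₁⟩) (exists_add_iff.mp ⟨e, h₂⟩))
  obtain ⟨z, hz⟩ := EA.exists_add_of_le ((left_le h₁).trans (le_sup_left (b := e)))
  have hb : b ≤ z := (add_le_iff h₁ hz).mp le_sup_left
  have hc : c ≤ z := (add_le_iff h₂ hz).mp le_sup_right
  rw [hw, _root_.le_antisymm ((add_le_iff hw hz).mpr (sup_le hb hc))
    (sup_le ((add_le_iff h₁ hw).mpr le_sup_left) ((add_le_iff h₂ hw).mpr le_sup_right))]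

/-- The truncated difference `a - (a ⊓ b)`. -/
noncomputable def tsub (EA : EffectAlgebra E) [EA.InducesOrder] (a b : E) : E :=
  Classical.choose (EA.exists_add_of_le (inf_le_left (a := a) (b := b)))

/-- The truncated sum `a + (aᗮ ⊓ b)`. -/
noncomputable def tadd (EA : EffectAlgebra E) [EA.InducesOrder] (a b : E) : E :=
  EA.orthosupp (EA.tsub (EA.orthosupp a) b)

theorem inf_add_tsub (EA : EffectAlgebra E) [EA.InducesOrder] (a b : E) :
    EA.add (a ⊓ b) (EA.tsub a b) = some a :=
  Classical.choose_spec (EA.exists_add_of_le (inf_le_left (a := a) (b := b)))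

theorem tsub_eq (h : EA.add (a ⊓ b) c = some a) : EA.tsub a b = c :=
  add_left_cancel (EA.inf_add_tsub a b) h

theorem add_inf_orthosupp (EA : EffectAlgebra E) [EA.InducesOrder] (a b : E) :
    EA.add a (EA.orthosupp a ⊓ b) = some (EA.tadd a b) := by
  obtain ⟨f, hf, hf'⟩ := add_assoc_left (EA.inf_add_tsub (EA.orthosupp a) b) (EA.add_orthosupp a)
  rw [hf, tadd, eq_orthosupp (add_symm hf')]

theorem tadd_eq (h : EA.add a b = some c) : EA.tadd a b = c := by
  have h' := EA.add_inf_orthosupp a b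
  rw [inf_eq_right.mpr (exists_add_iff.mp ⟨c, h⟩), h] at h'
  exact (Option.some.inj h').symm

theorem tsub_inf_tsub (EA : EffectAlgebra E) [EA.InducesOrder] (a b : E) :
    EA.tsub a b ⊓ EA.tsub b a = ⊥ := by
  have ha := EA.inf_add_tsub a b
  have hb := EA.inf_add_tsub b a
  rw [inf_comm] at hb
  obtain ⟨w, hwa, hw⟩ := add_mono ha le_rfl (inf_le_left (b := EA.tsub b a))
  have hwb : w ≤ b := (add_le_iff hw hb).mpr inf_le_right
  exact le_bot_iff.mp ((add_le_iff hw (EA.add_bot _)).mp (le_inf hwa hwb))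

/-- `a` and `b` are compatible: `a` splits into a part below `b` and a part orthogonal to `b`. -/
def Compat (EA : EffectAlgebra E) (a b : E) : Prop :=
  ∃ r p, EA.add r p = some a ∧ r ≤ b ∧ p ≤ EA.orthosupp b

theorem Compat.of_le (h : a ≤ b) : EA.Compat a b := ⟨a, ⊥, EA.add_bot a, h, bot_le⟩

theorem Compat.symm (h : EA.Compat a b) : EA.Compat b a := by
  obtain ⟨r, p, hrp, hr, hp⟩ := h
  obtain ⟨q, hq⟩ := EA.exists_add_of_le hr
  obtain ⟨w, hw⟩ := exists_add_iff.mpr hp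
  obtain ⟨f, hf, hf'⟩ := add_assoc_left hq (add_symm hw)
  obtain rfl := Option.some.inj ((add_symm hrp).symm.trans hf)
  exact ⟨r, q, hq, left_le hrp, exists_add_iff.mp ⟨w, hf'⟩⟩

omit [EA.InducesOrder] in
theorem Compat.orthosupp (h : EA.Compat a b) : EA.Compat a (EA.orthosupp b) := by
  obtain ⟨r, p, hrp, hr, hp⟩ := h
  exact ⟨p, r, add_symm hrp, hp, by rwa [orthosupp_orthosupp]⟩

theorem Compat.tsub_le (h : EA.Compat a b) : EA.tsub a b ≤ EA.orthosupp b := by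
  obtain ⟨r, p, hrp, hr, hp⟩ := h
  refine _root_.le_trans ?_ hp
  obtain ⟨x, hx⟩ := EA.exists_add_of_le (le_inf (left_le hrp) hr)
  obtain ⟨f, hf, hf'⟩ := add_assoc_right hx (EA.inf_add_tsub a b)
  obtain rfl := add_left_cancel hf' hrp
  exact right_le hf

theorem tsub_le_self : EA.tsub a b ≤ a := right_le (EA.inf_add_tsub a b)

theorem tsub_anti (h : b ≤ c) : EA.tsub a c ≤ EA.tsub a b := by
  obtain ⟨x, hx⟩ := EA.exists_add_of_le (inf_le_inf_left a h)
  obtain ⟨f, hf, hf'⟩ := add_assoc_right hx (EA.inf_add_tsub a c)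
  obtain rfl := add_left_cancel hf' (EA.inf_add_tsub a b)
  exact right_le hf

theorem compat_of_tsub_le (h : EA.tsub a b ≤ EA.orthosupp b) : EA.Compat a b :=
  ⟨_, _, EA.inf_add_tsub a b, inf_le_right, h⟩

theorem Compat.sSup {S : Set E} (h : ∀ b ∈ S, EA.Compat a b) : EA.Compat a (sSup S) :=
  compat_of_tsub_le <| le_orthosupp_comm.mpr <| sSup_le fun b hb =>
    le_orthosupp_comm.mpr ((tsub_anti (le_sSup hb)).trans (h b hb).tsub_le)

theorem Compat.sup (hb : EA.Compat a b) (hc : EA.Compat a c) : EA.Compat a (b ⊔ c) := by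
  rw [← sSup_pair]
  exact Compat.sSup (by simp [hb, hc])

theorem Compat.inf (hb : EA.Compat a b) (hc : EA.Compat a c) : EA.Compat a (b ⊓ c) := by
  have h := (hb.orthosupp.sup hc.orthosupp).orthosupp
  rwa [orthosupp_sup, orthosupp_orthosupp, orthosupp_orthosupp] at h

theorem Compat.add_tsub (h : EA.Compat a b) : EA.add b (EA.tsub a b) = some (a ⊔ b) := by
  have ha := EA.inf_add_tsub a b
  have hb := EA.inf_add_tsub b a
  rw [inf_comm] at hb
  obtain ⟨w, hw⟩ := exists_add_iff.mpr h.tsub_le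
  obtain ⟨f, hf, hf'⟩ := add_assoc_left hb (add_symm hw)
  obtain rfl := Option.some.inj ((add_symm ha).symm.trans hf)
  obtain ⟨r, hr⟩ := EA.exists_add_of_le (sup_le (left_le hf') (left_le hw))
  have hra : r ≤ EA.tsub a b := by
    obtain ⟨x, hx⟩ := EA.exists_add_of_le (le_sup_right (a := a) (b := b))
    obtain ⟨g, hg, hg'⟩ := add_assoc_right hx hr
    obtain rfl := add_left_cancel hg' hw
    exact right_le hg
  have hrb : r ≤ EA.tsub b a := by
    obtain ⟨x, hx⟩ := EA.exists_add_of_le (le_sup_left (a := a) (b := b))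
    obtain ⟨g, hg, hg'⟩ := add_assoc_right hx hr
    obtain rfl := add_left_cancel hg' hf'
    exact right_le hg
  have hr0 : r = ⊥ := le_bot_iff.mp ((le_inf hra hrb).trans (EA.tsub_inf_tsub a b).le)
  rw [hr0, add_bot] at hr
  rw [hw, ← Option.some.inj hr]

theorem compat_of_add_sup (h : EA.add b c = some (a ⊔ b)) (hc : c ≤ a) : EA.Compat a b := by
  obtain ⟨x, hx⟩ := EA.exists_add_of_le hc
  exact ⟨x, c, add_symm hx, (add_le_iff hx (add_symm h)).mp le_sup_left, exists_add_iff.mp ⟨_, h⟩⟩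

theorem Compat.of_add_left {q : E} (h : EA.Compat a c) (hq : q ≤ EA.orthosupp c)
    (hb : EA.add q b = some a) : EA.Compat b c := by
  obtain ⟨r, hr⟩ := EA.exists_add_of_le (le_sup_right (a := b) (b := c))
  refine compat_of_add_sup hr ?_
  obtain ⟨qc, hqc⟩ := exists_add_iff.mpr (le_orthosupp_comm.mp hq)
  have h1 := add_sup hb hqc
  have h2 := add_sup h.add_tsub (add_symm hqc)
  have h3 : a ⊔ c ⊔ qc = a ⊔ qc := by rw [sup_assoc, sup_eq_right.mpr (right_le hqc)]
  rw [h3] at h2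
  obtain ⟨f, hf, hf'⟩ := add_assoc_left hr h1
  obtain ⟨g, hg, hg'⟩ := add_assoc_right (add_symm hf) hf'
  obtain rfl := add_left_cancel hg' h2
  exact (add_le_iff hg hb).mp (sup_le tsub_le_self (left_le hb))

theorem Compat.add (hb : EA.Compat a b) (hc : EA.Compat a c) (h : EA.add b c = some d) :
    EA.Compat a d := by
  have hcb := exists_add_iff.mp ⟨d, h⟩
  have ha := EA.inf_add_tsub a b
  have h1 : EA.Compat (EA.tsub a b) c :=
    hc.of_add_left (inf_le_right.trans (le_orthosupp_comm.mp hcb)) ha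
  obtain ⟨w, hw⟩ := exists_add_iff.mpr (sup_le hb.tsub_le hcb)
  obtain ⟨f, hf, hf'⟩ := add_assoc_left h1.add_tsub hw
  obtain rfl := Option.some.inj (h.symm.trans hf)
  obtain ⟨g, hg, hg'⟩ := add_assoc_left (EA.inf_add_tsub (EA.tsub a b) c) ha
  obtain ⟨g', hgd, hg''⟩ := add_mono h inf_le_right inf_le_right
  obtain rfl := Option.some.inj (hg.symm.trans hg'')
  exact ⟨g, _, hg', hgd, exists_add_iff.mp ⟨w, hf'⟩⟩

theorem Compat.of_add_right (hb : EA.Compat a b) (hd : EA.Compat a d)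
    (h : EA.add b c = some d) : EA.Compat a c := by
  obtain ⟨f, hf, hf'⟩ := add_assoc_right h (EA.add_orthosupp d)
  obtain ⟨g, hg, hg'⟩ := add_assoc_left (add_symm hf) hf'
  rw [eq_orthosupp hg']
  exact (hb.add hd.orthosupp hg).orthosupp

theorem Compat.tsub (hb : EA.Compat a b) (hc : EA.Compat a c) : EA.Compat a (EA.tsub b c) :=
  (hb.inf hc).of_add_right hb (EA.inf_add_tsub b c)

theorem Compat.tadd (hb : EA.Compat a b) (hc : EA.Compat a c) : EA.Compat a (EA.tadd b c) :=
  (hb.orthosupp.tsub hc).orthosupp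

theorem Compat.tadd_comm (h : EA.Compat a b) : EA.tadd a b = EA.tadd b a := by
  have h1 := EA.inf_add_tsub a (EA.orthosupp b)
  have h2 := h.orthosupp.tsub_le
  rw [orthosupp_orthosupp] at h2
  obtain ⟨x, hx⟩ := EA.exists_add_of_le h2
  obtain ⟨f, hf, hf'⟩ := add_assoc_left hx (add_symm (EA.add_orthosupp b))
  obtain rfl := Option.some.inj (h.orthosupp.add_tsub.symm.trans hf)
  have h3 := eq_orthosupp hf'
  rw [orthosupp_sup, orthosupp_orthosupp] at h3
  subst h3
  obtain ⟨g, hg, hg'⟩ := add_assoc_right h1 (EA.add_inf_orthosupp a b)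
  obtain rfl := Option.some.inj (hx.symm.trans hg)
  rw [inf_comm] at hg'
  exact Option.some.inj ((add_symm hg').symm.trans (EA.add_inf_orthosupp b a))

theorem Compat.tsub_le_iff (hab : EA.Compat a b) (hbc : EA.Compat b c) :
    EA.tsub a b ≤ c ↔ a ≤ EA.tadd c b := by
  rw [← hbc.tadd_comm]
  constructor
  · intro h
    exact le_sup_left.trans
      ((add_le_iff hab.add_tsub (EA.add_inf_orthosupp b c)).mpr (le_inf hab.tsub_le h))
  · intro h
    exact ((add_le_iff hab.add_tsub (EA.add_inf_orthosupp b c)).mp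
      (sup_le h (left_le (EA.add_inf_orthosupp b c)))).trans inf_le_right

theorem Compat.tsub_tsub (hab : EA.Compat a b) (hac : EA.Compat a c) (hbc : EA.Compat b c) :
    EA.tsub (EA.tsub a b) c = EA.tsub a (EA.tadd b c) := by
  have hc1 := EA.add_inf_orthosupp b c
  have hy : EA.tsub (EA.tsub a b) c = EA.tsub (EA.tsub a b) (EA.orthosupp b ⊓ c) := by
    refine tsub_eq ?_
    have h := EA.inf_add_tsub (EA.tsub a b) (EA.orthosupp b ⊓ c)
    rwa [← inf_assoc, inf_eq_left.mpr hab.tsub_le] at h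
  have hcomp : EA.Compat (EA.tsub a b) (EA.orthosupp b ⊓ c) := by
    refine Compat.symm (Compat.tsub ?_ ?_)
    · exact (hab.orthosupp.inf hac).symm
    · exact (Compat.inf (Compat.of_le _root_.le_rfl).orthosupp hbc).symm
  have h1 := add_sup hab.add_tsub hc1
  obtain ⟨f, hf, hf'⟩ := add_assoc_left hcomp.add_tsub h1
  obtain rfl := Option.some.inj (hc1.symm.trans hf)
  rw [sup_assoc, sup_eq_right.mpr (left_le hc1)] at hf'
  rw [hy]
  exact add_left_cancel hf' (hab.tadd hac).add_tsub

theorem Compat.tadd_assoc (hab : EA.Compat a b) (hac : EA.Compat a c) (hbc : EA.Compat b c) :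
    EA.tadd (EA.tadd a b) c = EA.tadd a (EA.tadd b c) := by
  have h := hab.symm.orthosupp.symm.tsub_tsub hac.symm.orthosupp.symm hbc
  rw [EffectAlgebra.tadd, EffectAlgebra.tadd, orthosupp_orthosupp, h, ← EffectAlgebra.tadd]

end EffectAlgebra
/-- An MV-algebra presented as a bounded lattice with truncated sum and difference. -/
class MVLattice (M : Type*) extends Lattice M, BoundedOrder M, AddCommMonoid M, Sub M where
  sub_le_iff : ∀ a b c : M, a - b ≤ c ↔ a ≤ c + b
  zero_eq : (0 : M) = ⊥
  sub_inf_self : ∀ a b : M, a - (a ⊓ b) = a - b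
  sub_inf_sub : ∀ a b : M, (a - b) ⊓ (b - a) = ⊥
  add_sub_cancel : ∀ a b : M, b ≤ ⊤ - a → a + b - a = b
  sub_add_cancel : ∀ a b : M, a ≤ b → b - a + a = b
  sub_sub_cancel : ∀ a b : M, b ≤ a → a - (a - b) = b

namespace MVLattice

variable {M : Type*} [MVLattice M] {a b c e : M}

instance : OrderedSub M := ⟨sub_le_iff⟩

instance : IsOrderedAddMonoid M where
  add_le_add_left _ _ h _ := (sub_le_iff _ _ _).mp (((sub_le_iff _ _ _).mpr le_rfl).trans h)

instance : CanonicallyOrderedAdd M where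
  exists_add_of_le {a b} h := ⟨b - a, by rw [add_comm, sub_add_cancel _ _ h]⟩
  le_self_add a b := by
    simpa using add_le_add_right (zero_eq.le.trans bot_le : (0 : M) ≤ b) a
  le_add_self a b := by
    simpa using add_le_add_left (zero_eq.le.trans bot_le : (0 : M) ≤ b) a

theorem top_sub_top_sub (a : M) : ⊤ - (⊤ - a) = a := sub_sub_cancel _ _ le_top

theorem sub_comm_le : a ≤ b - c → c ≤ b → c ≤ b - a := fun h hc =>
  (sub_sub_cancel _ _ hc).ge.trans (tsub_le_tsub_left h b)

theorem sub_eq_self_of_inf_eq_bot (h : a ⊓ b = ⊥) : b - a = b := by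
  rw [← sub_inf_self, inf_comm, h, ← zero_eq, tsub_zero]

theorem sub_nsmul_eq_self (h : b - a = b) (k : ℕ) : b - k • a = b := by
  induction k with
  | zero => simp
  | succ k ih => rw [succ_nsmul, ← tsub_tsub, ih, h]

theorem inf_add_sub (a b : M) : a ⊓ b + (a - b) = a := by
  rw [← sub_inf_self a b, add_comm, sub_add_cancel _ _ inf_le_left]

/-- Every increasing sequence has a least upper bound. -/
class SigmaComplete (M : Type*) [MVLattice M] : Prop where
  exists_isLUB : ∀ f : ℕ → M, Monotone f → ∃ s, IsLUB (Set.range f) s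

theorem eq_zero_of_forall_le_sub {f : ℕ → M} {s : M} (hs : IsLUB (Set.range f) s) (he : e ≤ s)
    (h : ∀ n, f n ≤ s - e) : e = 0 := by
  have h1 : s ≤ s - e := hs.2 (by rintro _ ⟨n, rfl⟩; exact h n)
  rw [← sub_sub_cancel _ _ he, le_antisymm tsub_le_self h1, tsub_self]

theorem eq_zero_of_forall_nsmul_le [SigmaComplete M] (h : ∀ n : ℕ, n • e ≤ ⊤ - e) : e = 0 := by
  obtain ⟨d, hd⟩ := SigmaComplete.exists_isLUB (fun n : ℕ => n • e)
    (fun m n hmn => nsmul_le_nsmul_left zero_le hmn)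
  have hle : ∀ n : ℕ, n • e ≤ d := fun n => hd.1 ⟨n, rfl⟩
  refine eq_zero_of_forall_le_sub hd (by simpa using hle 1) fun n => ?_
  have h1 := add_sub_cancel e (n • e) ((h n))
  rw [← h1]
  refine tsub_le_tsub_right ?_ e
  simpa [succ_nsmul, add_comm] using hle (n + 1)

/-- Proper ideals. -/
structure IsProperIdeal (I : Set M) : Prop where
  zero_mem : (0 : M) ∈ I
  add_mem : ∀ {a b}, a ∈ I → b ∈ I → a + b ∈ I
  mem_of_le : ∀ {a b}, a ≤ b → b ∈ I → a ∈ I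
  top_notMem : ⊤ ∉ I

theorem IsProperIdeal.nsmul_mem {I : Set M} (hI : IsProperIdeal I) (h : a ∈ I) (n : ℕ) :
    n • a ∈ I := by
  induction n with
  | zero => simpa using hI.zero_mem
  | succ n ih => rw [succ_nsmul]; exact hI.add_mem ih h

variable (M) in
/-- The maximal ideals. -/
def MaxIdeal : Type _ := {N : Set M // Maximal IsProperIdeal N}

instance : Membership M (MaxIdeal M) := ⟨fun N a => a ∈ N.1⟩

namespace MaxIdeal

variable {N : MaxIdeal M}

theorem isProperIdeal (N : MaxIdeal M) : IsProperIdeal {a | a ∈ N} := N.2.1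

theorem zero_mem : (0 : M) ∈ N := N.isProperIdeal.zero_mem

theorem add_mem (ha : a ∈ N) (hb : b ∈ N) : a + b ∈ N := N.isProperIdeal.add_mem ha hb

theorem mem_of_le (h : a ≤ b) (hb : b ∈ N) : a ∈ N := N.isProperIdeal.mem_of_le h hb

theorem top_notMem : ⊤ ∉ N := N.isProperIdeal.top_notMem

theorem nsmul_mem (h : a ∈ N) (n : ℕ) : n • a ∈ N := N.isProperIdeal.nsmul_mem h n

/-- Congruence modulo `N` is transitive. -/
theorem sub_mem_trans (h₁ : a - b ∈ N) (h₂ : b - c ∈ N) : a - c ∈ N :=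
  mem_of_le tsub_le_tsub_add_tsub (add_mem h₁ h₂)

theorem mem_of_sub_mem (h : a - b ∈ N) (hb : b ∈ N) : a ∈ N :=
  mem_of_le le_tsub_add (add_mem h hb)

theorem sub_mem_of_le (h : a ≤ b) : a - b ∈ N := by
  rw [tsub_eq_zero_of_le h]; exact zero_mem

theorem exists_le {I : Set M} (hI : IsProperIdeal I) : ∃ N : MaxIdeal M, ∀ a ∈ I, a ∈ N := by
  have hchain : ∀ C ⊆ {J : Set M | IsProperIdeal J}, IsChain (· ⊆ ·) C → C.Nonempty →
      ∃ J ∈ {J : Set M | IsProperIdeal J}, ∀ s ∈ C, s ⊆ J := by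
    refine fun C hC hchain hne => ⟨⋃₀ C, ⟨?_, ?_, ?_, ?_⟩, fun s hs => Set.subset_sUnion_of_mem hs⟩
    · obtain ⟨J, hJ⟩ := hne
      exact ⟨J, hJ, (hC hJ).zero_mem⟩
    · rintro a b ⟨J, hJ, ha⟩ ⟨K, hK, hb⟩
      rcases hchain.total hJ hK with h | h
      · exact ⟨K, hK, (hC hK).add_mem (h ha) hb⟩
      · exact ⟨J, hJ, (hC hJ).add_mem ha (h hb)⟩
    · rintro a b hab ⟨J, hJ, hb⟩
      exact ⟨J, hJ, (hC hJ).mem_of_le hab hb⟩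
    · rintro ⟨J, hJ, h⟩
      exact (hC hJ).top_notMem h
  obtain ⟨N, hIN, hN⟩ := zorn_subset_nonempty _ hchain I hI
  exact ⟨⟨N, hN⟩, hIN⟩

theorem exists_nsmul (he : e ∉ N) (a : M) : ∃ n : ℕ, a - n • e ∈ N := by
  by_contra hcon
  have hcon' : ∀ n : ℕ, ⊤ - n • e ∉ N := fun n hn =>
    hcon ⟨n, mem_of_le (tsub_le_tsub_right le_top _) hn⟩
  have hI : IsProperIdeal {x : M | ∃ n : ℕ, x - n • e ∈ N} := by
    refine ⟨⟨0, by simpa using zero_mem⟩, ?_, ?_, ?_⟩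
    · rintro a b ⟨m, hm⟩ ⟨n, hn⟩
      refine ⟨m + n, mem_of_le ?_ (add_mem hm hn)⟩
      rw [add_nsmul]
      exact add_tsub_add_le_tsub_add_tsub
    · rintro a b hab ⟨n, hn⟩
      exact ⟨n, mem_of_le (tsub_le_tsub_right hab _) hn⟩
    · rintro ⟨n, hn⟩
      exact hcon' n hn
  exact he (N.2.2 hI (fun x hx => ⟨0, by rw [zero_nsmul, tsub_zero]; exact hx⟩)
    ⟨1, by simpa using zero_mem⟩)

theorem mem_or_mem_of_inf_eq_bot (h : a ⊓ b = ⊥) : a ∈ N ∨ b ∈ N := by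
  by_contra! hcon
  obtain ⟨n, hn⟩ := exists_nsmul hcon.1 b
  rw [sub_nsmul_eq_self (sub_eq_self_of_inf_eq_bot h)] at hn
  exact hcon.2 hn

theorem sub_mem_or_sub_mem (a b : M) : a - b ∈ N ∨ b - a ∈ N :=
  mem_or_mem_of_inf_eq_bot (sub_inf_sub a b)

theorem inf_mem_iff : a ⊓ b ∈ N ↔ a ∈ N ∨ b ∈ N := by
  refine ⟨fun h => ?_, fun h => h.elim (mem_of_le inf_le_left) (mem_of_le inf_le_right)⟩
  rcases sub_mem_or_sub_mem (N := N) a b with h' | h'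
  · exact .inl (inf_add_sub a b ▸ add_mem h h')
  · exact .inr (inf_add_sub b a ▸ add_mem (by rwa [inf_comm]) h')

theorem exists_notMem [SigmaComplete M] (he : e ≠ 0) : ∃ N : MaxIdeal M, e ∉ N := by
  obtain ⟨n, hn⟩ : ∃ n : ℕ, ¬ n • e ≤ ⊤ - e := by
    by_contra! hcon
    exact he (eq_zero_of_forall_nsmul_le hcon)
  set p := n • e - (⊤ - e)
  set q := (⊤ - e) - n • e
  have hp : p ≠ 0 := fun h => hn (tsub_eq_zero_iff_le.mp h)
  have hpq : ∀ k : ℕ, p - k • q = p :=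
    sub_nsmul_eq_self (sub_eq_self_of_inf_eq_bot (sub_inf_sub _ _))
  have hI : IsProperIdeal {x : M | ∃ k : ℕ, x ≤ k • q} := by
    refine ⟨⟨0, by simp⟩, ?_, fun hab ⟨k, hk⟩ => ⟨k, hab.trans hk⟩, ?_⟩
    · rintro a b ⟨j, hj⟩ ⟨k, hk⟩
      exact ⟨j + k, by rw [add_nsmul]; exact add_le_add hj hk⟩
    · rintro ⟨k, hk⟩
      exact hp (by rw [← hpq k, tsub_eq_zero_of_le (le_top.trans hk)])
  obtain ⟨N, hN⟩ := exists_le hI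
  refine ⟨N, fun h => ?_⟩
  have h1 : ⊤ - e ∈ N := mem_of_sub_mem (hN q ⟨1, by simp⟩) (nsmul_mem h n)
  exact top_notMem (mem_of_sub_mem h1 h)

end MaxIdeal

end MVLattice

open Filter Topology

namespace MVLattice

variable {M : Type*} [MVLattice M] {a b c d e : M}

theorem sub_top_sub_comm (a b : M) : a - (⊤ - b) = b - (⊤ - a) := by
  conv_lhs => rw [← top_sub_top_sub a]
  conv_rhs => rw [← top_sub_top_sub b]
  rw [tsub_tsub, tsub_tsub, add_comm]

theorem sub_add_sub_self_le (a b : M) : b - (a + b - a) ≤ a - (⊤ - b) := by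
  have h1 : a + (b ⊓ (⊤ - a)) - a = b ⊓ (⊤ - a) := add_sub_cancel _ _ inf_le_right
  calc b - (a + b - a) ≤ b - (b ⊓ (⊤ - a)) := by
        refine tsub_le_tsub_left ?_ b
        rw [← h1]
        exact tsub_le_tsub_right (add_le_add_right inf_le_left a) a
    _ = b - (⊤ - a) := sub_inf_self _ _
    _ = a - (⊤ - b) := sub_top_sub_comm _ _

theorem inf_sub_top_sub_sub (a b : M) : a ⊓ b - (⊤ - (a - b)) = 0 := by
  rw [sub_top_sub_comm, ← sub_inf_self a b]
  exact tsub_eq_zero_of_le (tsub_le_tsub_right le_top _)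

namespace MaxIdeal

variable {N : MaxIdeal M}

/-- The number of copies of `e` needed to cover `a` modulo `N`. -/
noncomputable def coverNum (N : MaxIdeal M) (e a : M) : ℕ := sInf {k : ℕ | a - k • e ∈ N}

theorem sub_coverNum_mem (he : e ∉ N) (a : M) : a - N.coverNum e a • e ∈ N :=
  Nat.sInf_mem (s := {k : ℕ | a - k • e ∈ N}) (exists_nsmul he a)

theorem coverNum_le {k : ℕ} (h : a - k • e ∈ N) : N.coverNum e a ≤ k := Nat.sInf_le h

theorem coverNum_mono (he : e ∉ N) (h : a - b ∈ N) : N.coverNum e a ≤ N.coverNum e b :=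
  coverNum_le (sub_mem_trans h (sub_coverNum_mem he b))

theorem coverNum_add_le (he : e ∉ N) (a b : M) :
    N.coverNum e (a + b) ≤ N.coverNum e a + N.coverNum e b := by
  refine coverNum_le (mem_of_le ?_ (add_mem (sub_coverNum_mem he a) (sub_coverNum_mem he b)))
  rw [add_nsmul]
  exact add_tsub_add_le_tsub_add_tsub

theorem nsmul_sub_mem {k : ℕ} (h : k < N.coverNum e a) : k • e - a ∈ N :=
  (sub_mem_or_sub_mem _ _).resolve_right fun h' => h.not_ge (coverNum_le h')

theorem add_coverNum_le (he : e ∉ N) (h : a - (⊤ - b) ∈ N) {j : ℕ} (hj : j • e - a ∈ N)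
    (hj' : j ≤ N.coverNum e (a + b)) : j + N.coverNum e b ≤ N.coverNum e (a + b) := by
  obtain ⟨i, hi⟩ := Nat.exists_eq_add_of_le hj'
  have h1 := sub_coverNum_mem he (a + b)
  rw [hi, add_nsmul] at h1
  have h2 : j • e + i • e - (a + i • e) ∈ N := mem_of_le (add_tsub_add_le_tsub_right ..) hj
  have h3 := sub_mem_trans h1 h2
  rw [← tsub_tsub] at h3
  have h4 : b - i • e ∈ N :=
    mem_of_le tsub_le_tsub_add_tsub (add_mem (mem_of_le (sub_add_sub_self_le a b) h) h3)
  have := coverNum_le h4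
  omega

theorem coverNum_add_coverNum_le (he : e ∉ N) (h : a - (⊤ - b) ∈ N) :
    N.coverNum e a + N.coverNum e b ≤ N.coverNum e (a + b) + 1 := by
  have hle : N.coverNum e a ≤ N.coverNum e (a + b) := coverNum_mono he (sub_mem_of_le le_self_add)
  have hle' : N.coverNum e b ≤ N.coverNum e (a + b) := coverNum_mono he (sub_mem_of_le le_add_self)
  rcases Nat.eq_zero_or_pos (N.coverNum e a) with h0 | h0
  · omega
  · have := add_coverNum_le he h (nsmul_sub_mem (Nat.sub_one_lt h0.ne')) (by omega)
    omega

theorem coverNum_add_coverNum_le_of_minimal (he : e ∉ N) (hmin : ∀ x ∉ N, e - x ∈ N)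
    (h : a - (⊤ - b) ∈ N) : N.coverNum e a + N.coverNum e b ≤ N.coverNum e (a + b) := by
  refine add_coverNum_le he h ?_ (coverNum_mono he (sub_mem_of_le le_self_add))
  rcases Nat.eq_zero_or_pos (N.coverNum e a) with h0 | h0
  · rw [h0, zero_nsmul]
    exact sub_mem_of_le (zero_le)
  obtain ⟨k, hk⟩ := Nat.exists_eq_add_of_le' h0
  have h1 : a - k • e ∉ N := fun h' => by
    have := coverNum_le h'
    omega
  have h2 : k • e - a ∈ N := nsmul_sub_mem (by omega)
  have h3 : e + k • e - ((a - k • e) + k • e) ∈ N :=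
    mem_of_le (add_tsub_add_le_tsub_right ..) (hmin _ h1)
  have h4 : (a - k • e) + k • e - a ∈ N := by
    refine mem_of_le ?_ h2
    rw [tsub_le_iff_right]
    calc a - k • e + k • e = (a - k • e) + (k • e ⊓ a + (k • e - a)) := by rw [inf_add_sub]
      _ = (k • e - a) + (a ⊓ k • e + (a - k • e)) := by rw [inf_comm]; ac_rfl
      _ ≤ (k • e - a) + a := by rw [inf_add_sub]
  rw [hk, succ_nsmul']
  exact sub_mem_trans h3 h4

theorem coverNum_top_pos (he : e ∉ N) : 0 < N.coverNum e ⊤ := by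
  by_contra! h0
  have h1 := sub_coverNum_mem he ⊤
  rw [Nat.le_zero.mp h0, zero_nsmul, tsub_zero] at h1
  exact top_notMem h1

theorem exists_coverNum_lt (he : e ∉ N) {x : M} (hx : x ∉ N) (hex : e - x ∉ N) :
    ∃ e' ∉ N, N.coverNum e ⊤ < N.coverNum e' ⊤ := by
  set y := e ⊓ x
  have hey : e - y ∉ N := by rwa [sub_inf_self]
  have hy : y ∉ N := fun h => (inf_mem_iff.mp h).elim he hx
  set f := y ⊓ (e - y)
  have hf : f ∉ N := fun h => (inf_mem_iff.mp h).elim hy hey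
  have hfe : f ≤ e - f := (inf_le_left).trans (sub_comm_le inf_le_right inf_le_left)
  have hff : f + f ≤ e := by
    calc f + f ≤ e - f + f := add_le_add_left hfe f
      _ = e := sub_add_cancel _ _ (hfe.trans tsub_le_self)
  refine ⟨f, hf, ?_⟩
  have h0 := coverNum_top_pos hf
  obtain ⟨k, hk⟩ := Nat.exists_eq_add_of_le' h0
  have h1 := sub_coverNum_mem hf ⊤
  rw [hk]
  rw [hk] at h1
  rcases k with _ | k
  · refine absurd (mem_of_le (hfe.trans (tsub_le_tsub_right le_top f)) ?_) hf
    simpa using h1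
  · refine Nat.lt_succ_of_le (coverNum_le (mem_of_le (tsub_le_tsub_left ?_ ⊤) h1))
    calc (k + 1 + 1) • f = k • f + (f + f) := by rw [succ_nsmul, succ_nsmul, add_assoc]
      _ ≤ k • e + e := add_le_add (nsmul_le_nsmul_right (hfe.trans tsub_le_self) k) hff
      _ = (k + 1) • e := (succ_nsmul _ _).symm

theorem exists_coverNum_gt (hN : ∀ e ∉ N, ∃ x ∉ N, e - x ∉ N) (n : ℕ) :
    ∃ e ∉ N, n < N.coverNum e ⊤ := by
  induction n with
  | zero => exact ⟨⊤, top_notMem, coverNum_top_pos top_notMem⟩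
  | succ n ih =>
    obtain ⟨e, he, hn⟩ := ih
    obtain ⟨x, hx, hex⟩ := hN e he
    obtain ⟨f, hf, hef⟩ := exists_coverNum_lt he hx hex
    exact ⟨f, hf, by omega⟩

theorem exists_approx_value (N : MaxIdeal M) (n : ℕ) : ∃ s : M → ℝ, s ⊤ = 1 ∧ (∀ a, 0 ≤ s a) ∧
    (∀ a b, a - b ∈ N → s a ≤ s b) ∧ (∀ a b, s (a + b) ≤ s a + s b) ∧
    ∀ a b, a - (⊤ - b) ∈ N → s a + s b ≤ s (a + b) + 1 / ((n : ℝ) + 1) := by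
  obtain ⟨e, he, h⟩ : ∃ e ∉ N, ∀ a b, a - (⊤ - b) ∈ N →
      ((N.coverNum e a : ℝ) + N.coverNum e b) / N.coverNum e ⊤ ≤
        N.coverNum e (a + b) / N.coverNum e ⊤ + 1 / ((n : ℝ) + 1) := by
    by_cases hN : ∃ e ∉ N, ∀ x ∉ N, e - x ∈ N
    · obtain ⟨e, he, hmin⟩ := hN
      refine ⟨e, he, fun a b hab => le_add_of_le_of_nonneg ?_ (by positivity)⟩
      gcongr
      exact_mod_cast coverNum_add_coverNum_le_of_minimal he hmin hab
    · push Not at hN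
      obtain ⟨e, he, hn⟩ := exists_coverNum_gt hN n
      refine ⟨e, he, fun a b hab => ?_⟩
      calc ((N.coverNum e a : ℝ) + N.coverNum e b) / N.coverNum e ⊤
          ≤ (N.coverNum e (a + b) + 1) / N.coverNum e ⊤ := by
            refine div_le_div_of_nonneg_right ?_ (Nat.cast_nonneg _)
            exact_mod_cast coverNum_add_coverNum_le he hab
        _ ≤ _ := by
            rw [add_div]
            gcongr
            exact_mod_cast hn
  have hpos : (0 : ℝ) < N.coverNum e ⊤ := by exact_mod_cast coverNum_top_pos he
  refine ⟨fun a => N.coverNum e a / N.coverNum e ⊤, div_self hpos.ne', fun a => by positivity,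
    fun a b hab => ?_, fun a b => ?_, fun a b hab => ?_⟩
  · exact div_le_div_of_nonneg_right (Nat.cast_le.mpr (coverNum_mono he hab)) hpos.le
  · rw [← add_div]
    refine div_le_div_of_nonneg_right ?_ hpos.le
    exact_mod_cast coverNum_add_le he a b
  · rw [← add_div]
    exact h a b hab

theorem exists_value (N : MaxIdeal M) : ∃ s : M → ℝ, s ⊤ = 1 ∧ (∀ a, 0 ≤ s a) ∧
    (∀ a b, a - b ∈ N → s a ≤ s b) ∧ (∀ a b, s (a + b) ≤ s a + s b) ∧
    ∀ a b, a - (⊤ - b) ∈ N → s (a + b) = s a + s b := by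
  choose s htop hnonneg hmono hsub hadd using N.exists_approx_value
  have hlim : ∀ a, ∃ l, Tendsto (fun n => s n a) (hyperfilter ℕ : Filter ℕ) (𝓝 l) := fun a => by
    obtain ⟨l, -, hl⟩ := (isCompact_Icc (a := (0 : ℝ)) (b := 1)).ultrafilter_le_nhds'
      ((hyperfilter ℕ).map fun n => s n a) (Eventually.of_forall (f := (hyperfilter ℕ : Filter ℕ))
        fun n => ⟨hnonneg n a, (hmono n a ⊤ (sub_mem_of_le le_top)).trans_eq (htop n)⟩)
    exact ⟨l, hl⟩
  choose l hl using hlim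
  have hsub' : ∀ a b, l (a + b) ≤ l a + l b := fun a b =>
    le_of_tendsto_of_tendsto' (hl _) ((hl a).add (hl b)) fun n => hsub n a b
  refine ⟨l, tendsto_nhds_unique (hl ⊤) (by simp [htop]),
    fun a => ge_of_tendsto' (hl a) fun n => hnonneg n a,
    fun a b hab => le_of_tendsto_of_tendsto' (hl a) (hl b) fun n => hmono n a b hab, hsub',
    fun a b hab => (hsub' a b).antisymm ?_⟩
  have h0 : Tendsto (fun n : ℕ => 1 / ((n : ℝ) + 1)) (hyperfilter ℕ : Filter ℕ) (𝓝 0) :=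
    tendsto_one_div_add_atTop_nhds_zero_nat.mono_left Nat.hyperfilter_le_atTop
  simpa using le_of_tendsto_of_tendsto' ((hl a).add (hl b)) ((hl (a + b)).add h0)
    fun n => hadd n a b hab

/-- The normalised additive functional attached to a maximal ideal. -/
noncomputable def val (N : MaxIdeal M) : M → ℝ := Classical.choose N.exists_value

theorem val_top (N : MaxIdeal M) : N.val ⊤ = 1 := (Classical.choose_spec N.exists_value).1

theorem val_nonneg (N : MaxIdeal M) (a : M) : 0 ≤ N.val a :=
  (Classical.choose_spec N.exists_value).2.1 a

theorem val_le_of_sub_mem (h : a - b ∈ N) : N.val a ≤ N.val b :=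
  (Classical.choose_spec N.exists_value).2.2.1 a b h

theorem val_add_le (N : MaxIdeal M) (a b : M) : N.val (a + b) ≤ N.val a + N.val b :=
  (Classical.choose_spec N.exists_value).2.2.2.1 a b

theorem val_add_of_mem (h : a - (⊤ - b) ∈ N) : N.val (a + b) = N.val a + N.val b :=
  (Classical.choose_spec N.exists_value).2.2.2.2 a b h

theorem val_mono (N : MaxIdeal M) : Monotone N.val := fun _ _ h =>
  val_le_of_sub_mem (sub_mem_of_le h)

theorem val_add (N : MaxIdeal M) (h : a ≤ ⊤ - b) : N.val (a + b) = N.val a + N.val b :=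
  val_add_of_mem (sub_mem_of_le h)

theorem val_zero (N : MaxIdeal M) : N.val 0 = 0 := by
  have h := N.val_add (a := 0) (b := 0) zero_le
  rw [add_zero] at h
  linarith

theorem val_nsmul_le (N : MaxIdeal M) (a : M) (n : ℕ) : N.val (n • a) ≤ n * N.val a := by
  induction n with
  | zero => simp [val_zero]
  | succ n ih =>
    rw [succ_nsmul]
    push_cast
    linarith [N.val_add_le (n • a) a]

theorem val_pos (h : a ∉ N) : 0 < N.val a := by
  obtain ⟨n, hn⟩ := exists_nsmul h ⊤
  have h1 := val_le_of_sub_mem hn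
  rw [val_top] at h1
  have h2 := N.val_nsmul_le a n
  refine (N.val_nonneg a).lt_of_ne fun h0 => ?_
  rw [← h0] at h2
  linarith

theorem val_eq_inf_add_sub (N : MaxIdeal M) (a b : M) :
    N.val a = N.val (a ⊓ b) + N.val (a - b) := by
  rw [← val_add_of_mem (by rw [inf_sub_top_sub_sub]; exact zero_mem), inf_add_sub]

theorem val_sub_of_le (N : MaxIdeal M) (h : b ≤ a) : N.val (a - b) = N.val a - N.val b := by
  have h1 := N.val_eq_inf_add_sub a b
  rw [inf_eq_right.mpr h] at h1
  linarith

theorem val_lt_of_sub_notMem (h : a - b ∉ N) : N.val b < N.val a := by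
  have h1 : b - a ⊓ b ∈ N := by
    rw [inf_comm, sub_inf_self]
    exact (sub_mem_or_sub_mem a b).resolve_left h
  linarith [val_le_of_sub_mem h1, N.val_eq_inf_add_sub a b, val_pos h]

theorem mul_val_le_one {k : ℕ} (h : ⊤ - k • d ∉ N) : k * N.val d ≤ 1 := by
  have key : N.val (k • d) = k * N.val d := by
    induction k with
    | zero => simp [val_zero]
    | succ k ih =>
      have h1 : ⊤ - k • d - d ∉ N := by rwa [tsub_tsub, ← succ_nsmul]
      have h2 : ⊤ - k • d ∉ N := fun h' => h1 (mem_of_le tsub_le_self h')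
      have h3 := (sub_mem_or_sub_mem _ _).resolve_right h1
      rw [succ_nsmul, add_comm, val_add_of_mem h3, ih h2]
      push_cast
      ring
  rw [← key, ← N.val_top]
  exact N.val_mono le_top

end MaxIdeal

end MVLattice

namespace MVLattice

variable {M : Type*} [MVLattice M] {a b c d e : M}

theorem eq_zero_of_forall_le_nsmul_sub {f : ℕ → M} (hf : Monotone f)
    (ha : IsLUB (Set.range f) a) (k : ℕ) (hb : ∀ n, b ≤ k • (a - f n)) : b = 0 := by
  induction k generalizing b with
  | zero => exact le_zero_iff.mp (by simpa using hb 0)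
  | succ k ih =>
    refine ih fun m => tsub_eq_zero_iff_le.mp ?_
    have h : ∀ n, b - k • (a - f m) ≤ a - f n := fun n => by
      rw [tsub_le_iff_left]
      refine (hb (max m n)).trans ?_
      rw [succ_nsmul]
      exact add_le_add (nsmul_le_nsmul_right (tsub_le_tsub_left (hf (le_max_left m n)) a) k)
        (tsub_le_tsub_left (hf (le_max_right m n)) a)
    exact eq_zero_of_forall_le_sub ha ((h 0).trans tsub_le_self)
      fun n => sub_comm_le (h n) (ha.1 ⟨n, rfl⟩)

namespace MaxIdeal

variable {N : MaxIdeal M}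

/-- The set of maximal ideals avoiding `a`. -/
def basicOpen (a : M) : Set (MaxIdeal M) := {N | a ∉ N}

theorem mem_basicOpen : N ∈ basicOpen a ↔ a ∉ N := Iff.rfl

instance : TopologicalSpace (MaxIdeal M) := .generateFrom (Set.range basicOpen)

theorem isOpen_basicOpen (a : M) : IsOpen (basicOpen a) := .basic _ ⟨a, rfl⟩

theorem isTopologicalBasis_range_basicOpen :
    TopologicalSpace.IsTopologicalBasis (Set.range (basicOpen (M := M))) := by
  have h := TopologicalSpace.isTopologicalBasis_of_subbasis_of_inter
    (r := Set.range (basicOpen (M := M))) rfl <| by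
      rintro _ ⟨a, rfl⟩ _ ⟨b, rfl⟩
      refine ⟨a ⊓ b, ?_⟩
      ext N
      simp only [Set.mem_inter_iff, mem_basicOpen, inf_mem_iff, not_or]
  rwa [Set.insert_eq_of_mem] at h
  exact ⟨⊤, Set.eq_univ_of_forall fun N => top_notMem⟩

theorem exists_finite_of_mem_closure {A : Set M} (h : a ∈ AddSubmonoid.closure A) :
    ∃ T ⊆ A, T.Finite ∧ ∀ N : MaxIdeal M, (∀ t ∈ T, t ∈ N) → a ∈ N := by
  induction h using AddSubmonoid.closure_induction with
  | mem x hx => exact ⟨{x}, by simpa using hx, Set.finite_singleton x, fun N h => h x rfl⟩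
  | zero => exact ⟨∅, Set.empty_subset _, Set.finite_empty, fun N _ => zero_mem⟩
  | add x y _ _ hx hy =>
    obtain ⟨S, hSA, hS, hS'⟩ := hx
    obtain ⟨T, hTA, hT, hT'⟩ := hy
    exact ⟨S ∪ T, Set.union_subset hSA hTA, hS.union hT, fun N h =>
      add_mem (hS' N fun t ht => h t (.inl ht)) (hT' N fun t ht => h t (.inr ht))⟩

instance : CompactSpace (MaxIdeal M) := by
  refine compactSpace_generateFrom rfl fun P hP hcover => ?_
  set A : Set M := {a | basicOpen a ∈ P}
  have hnot : ¬ IsProperIdeal {x : M | ∃ y ∈ AddSubmonoid.closure A, x ≤ y} := fun hI => by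
    obtain ⟨N, hN⟩ := exists_le hI
    obtain ⟨_, hU, hNU⟩ : N ∈ ⋃₀ P := hcover ▸ Set.mem_univ N
    obtain ⟨a, rfl⟩ := hP hU
    exact hNU (hN a ⟨a, AddSubmonoid.subset_closure hU, le_rfl⟩)
  obtain ⟨y, hy, hy'⟩ : (⊤ : M) ∈ {x : M | ∃ y ∈ AddSubmonoid.closure A, x ≤ y} := by
    by_contra htop
    refine hnot ⟨⟨0, AddSubmonoid.zero_mem _, le_rfl⟩, ?_, ?_, htop⟩
    · rintro a b ⟨y, hy, hay⟩ ⟨z, hz, hbz⟩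
      exact ⟨y + z, AddSubmonoid.add_mem _ hy hz, add_le_add hay hbz⟩
    · rintro a b hab ⟨y, hy, hby⟩
      exact ⟨y, hy, hab.trans hby⟩
  obtain ⟨T, hTA, hT, hT'⟩ := exists_finite_of_mem_closure hy
  refine ⟨basicOpen '' T, by rintro _ ⟨t, ht, rfl⟩; exact hTA ht, hT.image _,
    Set.eq_univ_of_forall fun N => ?_⟩
  by_contra hN
  refine top_notMem (mem_of_le hy' (hT' N fun t ht => ?_))
  by_contra htN
  exact hN ⟨_, ⟨t, ht, rfl⟩, htN⟩

instance : T2Space (MaxIdeal M) := by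
  refine ⟨fun N N' hne => ?_⟩
  obtain ⟨a, ha, ha'⟩ : ∃ a, a ∈ N ∧ a ∉ N' := by
    by_contra! hsub
    exact hne (Subtype.ext (N.2.eq_of_le N'.2.1 hsub))
  obtain ⟨n, hn⟩ := exists_nsmul ha' ⊤
  have hx : n • a ∈ N := nsmul_mem ha n
  refine ⟨_, _, isOpen_basicOpen ((⊤ - n • a) - n • a), isOpen_basicOpen (n • a - (⊤ - n • a)),
    fun h => ?_, fun h => ?_, Set.disjoint_left.mpr fun K h h' => ?_⟩
  · exact top_notMem (mem_of_sub_mem (mem_of_sub_mem h hx) hx)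
  · exact top_notMem (mem_of_sub_mem hn (mem_of_sub_mem h hn))
  · exact (sub_mem_or_sub_mem _ _).elim h h'

variable [SigmaComplete M]

theorem basicOpen_nonempty (h : a ≠ 0) : (basicOpen a).Nonempty := exists_notMem h

theorem exists_of_eventually_residual {P : MaxIdeal M → Prop} (ha : a ≠ 0)
    (h : ∀ᶠ N in residual (MaxIdeal M), P N) : ∃ N, a ∉ N ∧ P N :=
  (dense_of_mem_residual h).inter_open_nonempty _ (isOpen_basicOpen a) (basicOpen_nonempty ha)

theorem le_of_eventually_val_le (h : ∀ᶠ N in residual (MaxIdeal M), N.val a ≤ N.val b) :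
    a ≤ b := by
  by_contra hab
  obtain ⟨N, hN, hle⟩ := exists_of_eventually_residual (fun h0 => hab (tsub_eq_zero_iff_le.mp h0)) h
  exact (val_lt_of_sub_notMem hN).not_ge hle

theorem eq_of_eventually_val_eq (h : ∀ᶠ N in residual (MaxIdeal M), N.val a = N.val b) : a = b :=
  (le_of_eventually_val_le (h.mono fun _ => le_of_eq)).antisymm
    (le_of_eventually_val_le (h.mono fun _ => ge_of_eq))

theorem eventually_exists_mul_val_sub_le {f : ℕ → M} (hf : Monotone f)
    (ha : IsLUB (Set.range f) a) (k : ℕ) :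
    ∀ᶠ N in residual (MaxIdeal M), ∃ n, (k : ℝ) * N.val (a - f n) ≤ 1 := by
  have hopen : IsOpen (⋃ n, basicOpen (⊤ - k • (a - f n))) :=
    isOpen_iUnion fun n => isOpen_basicOpen _
  refine mem_of_superset (residual_of_dense_open hopen ?_) fun N hN => ?_
  · rw [isTopologicalBasis_range_basicOpen.dense_iff]
    rintro _ ⟨b, rfl⟩ ⟨N, hN⟩
    by_contra hempty
    have h0 : ∀ n, b ⊓ (⊤ - k • (a - f n)) = ⊥ := fun n => by
      rw [← zero_eq]
      by_contra hne
      obtain ⟨K, hK⟩ := exists_notMem hne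
      rw [inf_mem_iff, not_or] at hK
      exact hempty ⟨K, hK.1, Set.mem_iUnion.mpr ⟨n, hK.2⟩⟩
    have hb : b = 0 := eq_zero_of_forall_le_nsmul_sub hf ha k fun n => by
      have h1 := sub_eq_self_of_inf_eq_bot (b := b) (inf_comm b _ ▸ h0 n)
      calc b = b - (⊤ - k • (a - f n)) := h1.symm
        _ ≤ ⊤ - (⊤ - k • (a - f n)) := tsub_le_tsub_right le_top _
        _ = k • (a - f n) := top_sub_top_sub _
    exact hN (hb ▸ zero_mem)
  · obtain ⟨n, hn⟩ := Set.mem_iUnion.mp hN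
    exact ⟨n, mul_val_le_one hn⟩

/-- Residually, the functionals `val` are continuous along a given increasing sequence. -/
theorem eventually_tendsto_val {f : ℕ → M} (hf : Monotone f) (ha : IsLUB (Set.range f) a) :
    ∀ᶠ N in residual (MaxIdeal M), Tendsto (fun n => N.val (f n)) atTop (𝓝 (N.val a)) := by
  filter_upwards [eventually_countable_forall.mpr (eventually_exists_mul_val_sub_le hf ha)]
    with N hN
  refine tendsto_atTop_isLUB (fun m n h => N.val_mono (hf h)) ⟨?_, fun u hu => ?_⟩
  · rintro _ ⟨n, rfl⟩
    exact N.val_mono (ha.1 ⟨n, rfl⟩)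
  · refine le_of_forall_pos_le_add fun ε hε => ?_
    obtain ⟨k, hk⟩ := exists_nat_one_div_lt hε
    obtain ⟨n, hn⟩ := hN (k + 1)
    rw [N.val_sub_of_le (ha.1 ⟨n, rfl⟩), mul_comm] at hn
    push_cast at hn
    have h1 := (le_div_iff₀ (by positivity)).mpr hn
    linarith [hu ⟨n, rfl⟩]

end MaxIdeal

end MVLattice

open MeasureTheory

/-- Borel sets of the line are generated from the rays `Iio t` under complements, disjoint unions
and increasing countable unions. -/
theorem measurableSet_real_induction {C : Set ℝ → Prop} (empty : C ∅) (Iio : ∀ t, C (Set.Iio t))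
    (compl : ∀ A, MeasurableSet A → C A → C Aᶜ)
    (union : ∀ A B, MeasurableSet A → MeasurableSet B → Disjoint A B → C A → C B → C (A ∪ B))
    (iUnion : ∀ f : ℕ → Set ℝ, Monotone f → (∀ n, MeasurableSet (f n)) → (∀ n, C (f n)) →
      C (⋃ n, f n)) (A : Set ℝ) (hA : MeasurableSet A) : C A := by
  refine MeasurableSpace.induction_on_inter (C := fun A _ => C A)
    (BorelSpace.measurable_eq.trans (borel_eq_generateFrom_Iio ℝ)) isPiSystem_Iio empty
    (by rintro _ ⟨t, rfl⟩; exact Iio t) compl (fun f hd hf hC => ?_) A hA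
  have hmeas : ∀ n, MeasurableSet (⋃ k < n, f k) := fun n =>
    .biUnion (Set.to_countable {k | k < n}) fun k _ => hf k
  have h : C (⋃ n, ⋃ k < n, f k) := by
    refine iUnion _ (fun m n hmn => Set.biUnion_mono (fun k hk => lt_of_lt_of_le hk hmn)
      fun _ _ => le_rfl)
      hmeas fun n => ?_
    induction n with
    | zero => simpa using empty
    | succ n ih =>
      rw [Set.biUnion_lt_succ]
      refine union _ _ (hmeas n) (hf n) ?_ ih (hC n)
      simp only [Set.disjoint_iUnion_left]
      exact fun k hk => hd hk.ne
  convert h using 1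
  ext x
  simp only [Set.mem_iUnion, exists_prop]
  exact ⟨fun ⟨k, hk⟩ => ⟨k + 1, k, k.lt_succ_self, hk⟩, fun ⟨_, k, _, hk⟩ => ⟨k, hk⟩⟩

theorem exists_isProbabilityMeasure_real_Iio_eq_leftLim {f : ℝ → ℝ} (hf : Monotone f)
    (hbot : Tendsto f atBot (𝓝 0)) (htop : Tendsto f atTop (𝓝 1)) :
    ∃ μ : Measure ℝ, IsProbabilityMeasure μ ∧ ∀ t, μ.real (Set.Iio t) = Function.leftLim f t := by
  have hbot' : Tendsto hf.stieltjesFunction atBot (𝓝 0) := tendsto_rightLim_atBot_of_tendsto hbot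
  have htop' : Tendsto hf.stieltjesFunction atTop (𝓝 1) := tendsto_rightLim_atTop_of_tendsto htop
  refine ⟨_, hf.stieltjesFunction.isProbabilityMeasure hbot' htop', fun t => ?_⟩
  have h : Function.leftLim hf.stieltjesFunction t = Function.leftLim f t :=
    leftLim_rightLim (hf.tendsto_leftLim t)
  rw [Measure.real, hf.stieltjesFunction.measure_Iio hbot', h, sub_zero,
    ENNReal.toReal_ofReal]
  exact le_of_tendsto hbot ((eventually_lt_atBot t).mono fun s hs => hf.le_leftLim hs)

namespace MVLattice

namespace MaxIdeal

variable {M : Type*} [MVLattice M] [SigmaComplete M] {c d : M}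

/-- `c` represents `A` if `val · c` is residually the measure of `A`. -/
def Represents (μ : MaxIdeal M → Measure ℝ) (c : M) (A : Set ℝ) : Prop :=
  ∀ᶠ N in residual (MaxIdeal M), N.val c = (μ N).real A

namespace Represents

variable {μ : MaxIdeal M → Measure ℝ} {A B : Set ℝ}

theorem unique (hc : Represents μ c A) (hd : Represents μ d A) : c = d :=
  eq_of_eventually_val_eq <| by
    filter_upwards [hc, hd] with N h h'
    rw [h, h']

variable [∀ N, IsProbabilityMeasure (μ N)]

theorem mono (hc : Represents μ c A) (hd : Represents μ d B) (h : A ⊆ B) : c ≤ d :=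
  le_of_eventually_val_le <| by
    filter_upwards [hc, hd] with N h₁ h₂
    rw [h₁, h₂]
    exact measureReal_mono h

omit [SigmaComplete M] in
theorem compl (hc : Represents μ c A) (hA : MeasurableSet A) : Represents μ (⊤ - c) Aᶜ := by
  filter_upwards [hc] with N h
  rw [N.val_sub_of_le le_top, N.val_top, probReal_compl_eq_one_sub hA, h]

theorem le_top_sub (hc : Represents μ c A) (hd : Represents μ d B) (hB : MeasurableSet B)
    (h : Disjoint A B) : c ≤ ⊤ - d :=
  hc.mono (hd.compl hB) h.subset_compl_right

theorem union (hc : Represents μ c A) (hd : Represents μ d B) (hB : MeasurableSet B)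
    (h : Disjoint A B) : Represents μ (c + d) (A ∪ B) := by
  filter_upwards [hc, hd] with N h₁ h₂
  rw [N.val_add (hc.le_top_sub hd hB h), measureReal_union h hB, h₁, h₂]

theorem iUnion {f : ℕ → Set ℝ} {c : ℕ → M} (hf : Monotone f)
    (hc : ∀ n, Represents μ (c n) (f n)) {s : M} (hs : IsLUB (Set.range c) s) :
    Represents μ s (⋃ n, f n) := by
  filter_upwards [eventually_countable_forall.mpr hc,
    eventually_tendsto_val (fun m n h => (hc m).mono (hc n) (hf h)) hs] with N h h'
  refine tendsto_nhds_unique h' ?_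
  simp only [h]
  exact (ENNReal.tendsto_toReal (measure_ne_top _ _)).comp (tendsto_measure_iUnion_atTop hf)

end Represents

theorem exists_measure {F : ℝ → M} (hF : Monotone F) (hlub : ∀ t, IsLUB (F '' Set.Iio t) (F t))
    {l u : ℝ} (hl : ∀ t ≤ l, F t = ⊥) (hu : ∀ t ≥ u, F t = ⊤) :
    ∃ μ : MaxIdeal M → Measure ℝ, (∀ N, IsProbabilityMeasure (μ N)) ∧
      ∀ t, Represents μ (F t) (Set.Iio t) := by
  have hmono : ∀ N : MaxIdeal M, Monotone fun t => N.val (F t) := fun N => N.val_mono.comp hF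
  have h (N : MaxIdeal M) := exists_isProbabilityMeasure_real_Iio_eq_leftLim (hmono N)
    (tendsto_const_nhds.congr' <| (eventually_le_atBot l).mono fun t ht => by
      dsimp only
      rw [hl t ht, ← zero_eq, val_zero])
    (tendsto_const_nhds.congr' <| (eventually_ge_atTop u).mono fun t ht => by
      dsimp only
      rw [hu t ht, val_top])
  choose μ hμ hμF using h
  refine ⟨μ, hμ, fun t => ?_⟩
  obtain ⟨q, hq, hqt, hq'⟩ := exists_seq_strictMono_tendsto_nhdsWithin t
  have hs : IsLUB (Set.range (F ∘ q)) (F t) := by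
    refine ⟨?_, fun b hb => (hlub t).2 ?_⟩
    · rintro _ ⟨n, rfl⟩
      exact hF (hqt n).le
    · rintro _ ⟨x, hx, rfl⟩
      obtain ⟨n, hn⟩ := ((tendsto_nhds_of_tendsto_nhdsWithin hq').eventually
        (eventually_gt_nhds hx)).exists
      exact (hF hn.le).trans (hb ⟨n, rfl⟩)
  filter_upwards [eventually_tendsto_val (hF.comp hq.monotone) hs] with N hN
  rw [hμF]
  exact tendsto_nhds_unique hN (((hmono N).tendsto_leftLim t).comp hq')

theorem exists_represents {μ : MaxIdeal M → Measure ℝ} [∀ N, IsProbabilityMeasure (μ N)]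
    (h : ∀ t, ∃ c, Represents μ c (Set.Iio t)) (A : Set ℝ) (hA : MeasurableSet A) :
    ∃ c, Represents μ c A := by
  refine measurableSet_real_induction (C := fun A => ∃ c, Represents μ c A)
    ⟨0, .of_forall fun N => by simp [val_zero]⟩ h (fun A hA ⟨c, hc⟩ => ⟨_, hc.compl hA⟩)
    (fun A B _ hB hAB ⟨c, hc⟩ ⟨d, hd⟩ => ⟨_, hc.union hd hB hAB⟩) (fun f hf _ h => ?_) A hA
  choose c hc using h
  obtain ⟨s, hs⟩ := SigmaComplete.exists_isLUB c fun m n h => (hc m).mono (hc n) (hf h)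
  exact ⟨s, .iUnion hf hc hs⟩

end MaxIdeal

end MVLattice

namespace EffectAlgebra

variable {E : Type*} {EA : EffectAlgebra E} [CompleteLattice E] [EA.InducesOrder] {a b : E}
  {B K : Set E}

theorem top_tsub (a : E) : EA.tsub ⊤ a = EA.orthosupp a :=
  tsub_eq (by rw [top_inf_eq, add_orthosupp, one_eq_top])

/-- A set of pairwise compatible elements closed under all operations. -/
structure IsBlock (EA : EffectAlgebra E) [EA.InducesOrder] (B : Set E) : Prop where
  compat : ∀ a ∈ B, ∀ b ∈ B, EA.Compat a b
  sSup_mem : ∀ S ⊆ B, sSup S ∈ B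
  orthosupp_mem : ∀ a ∈ B, EA.orthosupp a ∈ B
  tsub_mem : ∀ a ∈ B, ∀ b ∈ B, EA.tsub a b ∈ B

namespace IsBlock

theorem bot_mem (hB : EA.IsBlock B) : ⊥ ∈ B := sSup_empty (α := E) ▸ hB.sSup_mem ∅ (by simp)

theorem top_mem (hB : EA.IsBlock B) : ⊤ ∈ B := by
  rw [← EA.one_eq_top, eq_orthosupp (add_symm (EA.add_zero EA.one)), EA.zero_eq_bot]
  exact hB.orthosupp_mem _ hB.bot_mem

theorem sup_mem (hB : EA.IsBlock B) (ha : a ∈ B) (hb : b ∈ B) : a ⊔ b ∈ B :=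
  sSup_pair (a := a) (b := b) ▸ hB.sSup_mem _ (Set.pair_subset ha hb)

theorem inf_mem (hB : EA.IsBlock B) (ha : a ∈ B) (hb : b ∈ B) : a ⊓ b ∈ B := by
  rw [← EA.orthosupp_orthosupp a, ← EA.orthosupp_orthosupp b, ← orthosupp_sup]
  exact hB.orthosupp_mem _ (hB.sup_mem (hB.orthosupp_mem _ ha) (hB.orthosupp_mem _ hb))

theorem tadd_mem (hB : EA.IsBlock B) (ha : a ∈ B) (hb : b ∈ B) : EA.tadd a b ∈ B :=
  hB.orthosupp_mem _ (hB.tsub_mem _ (hB.orthosupp_mem _ ha) _ hb)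

/-- The MV-algebra structure of a block. -/
noncomputable abbrev mvLattice (hB : EA.IsBlock B) : MVLattice B where
  __ := Subtype.lattice (P := (· ∈ B)) (fun _ _ ha hb => hB.sup_mem ha hb)
    fun _ _ ha hb => hB.inf_mem ha hb
  top := ⟨⊤, hB.top_mem⟩
  le_top a := (le_top : a.1 ≤ ⊤)
  bot := ⟨⊥, hB.bot_mem⟩
  bot_le a := (bot_le : ⊥ ≤ a.1)
  add a b := ⟨EA.tadd a b, hB.tadd_mem a.2 b.2⟩
  add_assoc a b c := Subtype.ext <| (hB.compat _ a.2 _ b.2).tadd_assoc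
    (hB.compat _ a.2 _ c.2) (hB.compat _ b.2 _ c.2)
  zero := ⟨⊥, hB.bot_mem⟩
  zero_add a := Subtype.ext <| tadd_eq (add_symm (EA.add_bot a.1))
  add_zero a := Subtype.ext <| tadd_eq (EA.add_bot a.1)
  add_comm a b := Subtype.ext (hB.compat _ a.2 _ b.2).tadd_comm
  nsmul := @nsmulRec _ ⟨⟨⊥, hB.bot_mem⟩⟩ ⟨fun a b => ⟨EA.tadd a b, hB.tadd_mem a.2 b.2⟩⟩
  sub a b := ⟨EA.tsub a b, hB.tsub_mem _ a.2 _ b.2⟩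
  sub_le_iff a b c := (hB.compat _ a.2 _ b.2).tsub_le_iff (hB.compat _ b.2 _ c.2)
  zero_eq := rfl
  sub_inf_self a b := Subtype.ext <| tsub_eq <| by
    change EA.add (a.1 ⊓ (a.1 ⊓ b.1)) _ = _
    rw [inf_left_idem]
    exact EA.inf_add_tsub a.1 b.1
  sub_inf_sub a b := Subtype.ext (EA.tsub_inf_tsub a.1 b.1)
  add_sub_cancel a b h := Subtype.ext <| tsub_eq <| by
    have h' : b.1 ≤ EA.orthosupp a := le_of_le_of_eq h (top_tsub a.1)
    have h1 := EA.add_inf_orthosupp a.1 b.1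
    rw [inf_eq_right.mpr h'] at h1
    change EA.add (EA.tadd a.1 b.1 ⊓ a.1) b.1 = some (EA.tadd a.1 b.1)
    rwa [inf_eq_right.mpr (left_le h1)]
  sub_add_cancel a b h := Subtype.ext <| tadd_eq <| add_symm <| by
    have h1 := EA.inf_add_tsub b.1 a.1
    rwa [inf_eq_right.mpr (show a.1 ≤ b.1 from h)] at h1
  sub_sub_cancel a b h := Subtype.ext <| tsub_eq <| by
    have h1 := EA.inf_add_tsub a.1 b.1
    rw [inf_eq_right.mpr (show b.1 ≤ a.1 from h)] at h1
    change EA.add (a.1 ⊓ EA.tsub a.1 b.1) b.1 = some a.1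
    rw [inf_eq_right.mpr tsub_le_self]
    exact add_symm h1

end IsBlock

/-- The elements compatible with every member of `K`. -/
def commutant (EA : EffectAlgebra E) (K : Set E) : Set E := {a | ∀ k ∈ K, EA.Compat a k}

theorem subset_commutant_commutant : K ⊆ EA.commutant (EA.commutant K) :=
  fun k hk _ hc => (hc k hk).symm

theorem isBlock_commutant_commutant (hK : ∀ a ∈ K, ∀ b ∈ K, EA.Compat a b) :
    EA.IsBlock (EA.commutant (EA.commutant K)) where
  compat _ ha _ hb := ha _ fun k hk => hb k (hK k hk)
  sSup_mem _ hS c hc := (Compat.sSup fun _ hb => (hS hb c hc).symm).symm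
  orthosupp_mem _ ha c hc := (ha c hc).symm.orthosupp.symm
  tsub_mem _ ha _ hb c hc := ((ha c hc).symm.tsub (hb c hc).symm).symm

open MVLattice MaxIdeal in
theorem exists_observable {F : ℝ → E} (hF : Monotone F)
    (hlub : ∀ t, IsLUB (F '' Set.Iio t) (F t)) {l u : ℝ} (hl : ∀ t ≤ l, F t = ⊥)
    (hu : ∀ t ≥ u, F t = ⊤) : ∃ z : Observable EA, ∀ t, z.toFun (bIio t) = F t := by
  have hK : ∀ a ∈ Set.range F, ∀ b ∈ Set.range F, EA.Compat a b := by
    rintro _ ⟨s, rfl⟩ _ ⟨t, rfl⟩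
    exact (le_total s t).elim (fun h => .of_le (hF h)) fun h => (Compat.of_le (hF h)).symm
  have hB := isBlock_commutant_commutant hK
  set B := EA.commutant (EA.commutant (Set.range F))
  let := hB.mvLattice
  have hsup : ∀ f : ℕ → B, ∃ h, IsLUB (Set.range f) ⟨sSup (Set.range fun n => (f n).1), h⟩ :=
    fun f => ⟨hB.sSup_mem _ (by rintro _ ⟨n, rfl⟩; exact (f n).2),
      by rintro _ ⟨n, rfl⟩; exact le_sSup (α := E) ⟨n, rfl⟩,
      fun b hb => sSup_le (α := E) (by rintro _ ⟨n, rfl⟩; exact hb ⟨n, rfl⟩)⟩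
  have : SigmaComplete B := ⟨fun f _ => ⟨_, (hsup f).choose_spec⟩⟩
  obtain ⟨μ, hμ, hμF⟩ := exists_measure
    (F := fun t => (⟨F t, subset_commutant_commutant ⟨t, rfl⟩⟩ : B))
    (fun s t h => hF h)
    (fun t => ⟨by rintro _ ⟨s, hs, rfl⟩; exact (hlub t).1 ⟨s, hs, rfl⟩,
      fun b hb => (hlub t).2 (by rintro _ ⟨s, hs, rfl⟩; exact hb ⟨s, hs, rfl⟩)⟩)
    (fun t ht => Subtype.ext (hl t ht)) (fun t ht => Subtype.ext (hu t ht))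
  choose φ hφ using exists_represents (μ := μ) fun t => ⟨_, hμF t⟩
  refine ⟨⟨fun A => φ A.1 A.2, ?_, fun A C h => ?_, fun f hf => ?_⟩, fun t => ?_⟩
  · rw [EA.one_eq_top]
    have h : Represents μ (⊤ : B) Set.univ := .of_forall fun N => by rw [val_top, probReal_univ]
    exact congrArg Subtype.val ((hφ _ MeasurableSet.univ).unique h)
  · have h1 := (hφ _ A.2).le_top_sub (hφ _ C.2) C.2 h
    have h2 := (hφ _ (A.2.union C.2)).unique ((hφ _ A.2).union (hφ _ C.2) C.2 h)
    have h3 := le_orthosupp_comm.mp (le_of_le_of_eq h1 (top_tsub (φ C.1 C.2).1))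
    rw [h2]
    obtain ⟨c, hc⟩ := exists_add_iff.mpr h3
    exact hc.trans (congrArg some (tadd_eq hc).symm)
  · obtain ⟨hmem, hs⟩ := hsup fun n => φ (f n).1 (f n).2
    have h1 := (hφ _ (.iUnion fun n => (f n).2)).unique
      (Represents.iUnion (monotone_nat_of_le_succ hf) (fun n => hφ _ (f n).2) hs)
    rw [isSup_iff_isLUB, h1]
    exact isLUB_sSup _
  · exact congrArg Subtype.val ((hφ _ measurableSet_Iio).unique (hμF t))

end EffectAlgebra

namespace EffectAlgebra

variable {E : Type*} {EA : EffectAlgebra E} {a : E}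

theorem zero_le (EA : EffectAlgebra E) (a : E) : EA.le EA.zero a := ⟨a, add_symm (EA.add_zero a)⟩

theorem le_one (EA : EffectAlgebra E) (a : E) : EA.le a EA.one := ⟨_, EA.add_orthosupp a⟩

theorem eq_one_of_one_le (h : EA.le EA.one a) : a = EA.one := le_antisymm (EA.le_one a) h

end EffectAlgebra

namespace Observable

open EffectAlgebra

variable {E : Type*} {EA : EffectAlgebra E} (x : Observable EA)

theorem toFun_empty : x.toFun ⟨∅, MeasurableSet.empty⟩ = EA.zero := by
  have h := x.additive ⟨∅, MeasurableSet.empty⟩ ⟨Set.univ, MeasurableSet.univ⟩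
    (Set.empty_disjoint _)
  rw [x.unital] at h
  exact EA.pos_one _ _ h

theorem toFun_compl (A : BorelSet) : x.toFun ⟨A.1ᶜ, A.2.compl⟩ = EA.orthosupp (x.toFun A) := by
  have h := x.additive A ⟨A.1ᶜ, A.2.compl⟩ disjoint_compl_right
  simp only [Set.union_compl_self, x.unital] at h
  exact eq_orthosupp h

theorem le_of_subset {A B : BorelSet} (h : A.1 ⊆ B.1) : EA.le (x.toFun A) (x.toFun B) := by
  have h' := x.additive A ⟨B.1 \ A.1, B.2.diff A.2⟩ Set.disjoint_sdiff_right
  simp only [Set.union_sdiff_cancel h] at h'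
  exact ⟨_, h'⟩

theorem eq_of_Iio {x y : Observable EA} (h : ∀ t, x.toFun (bIio t) = y.toFun (bIio t)) :
    x = y := by
  suffices ∀ A : Set ℝ, MeasurableSet A → ∀ hA : MeasurableSet A,
      x.toFun ⟨A, hA⟩ = y.toFun ⟨A, hA⟩ by
    cases x
    cases y
    congr
    exact funext fun A => this A.1 A.2 A.2
  refine fun A hA => measurableSet_real_induction
    (C := fun A => ∀ hA : MeasurableSet A, x.toFun ⟨A, hA⟩ = y.toFun ⟨A, hA⟩)
    (fun _ => by rw [toFun_empty, toFun_empty]) (fun t _ => h t)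
    (fun A hA ih _ => ?_) (fun A B hA hB hAB ihA ihB _ => ?_) (fun f hf hfm ih _ => ?_) A hA
  · rw [x.toFun_compl ⟨A, hA⟩, y.toFun_compl ⟨A, hA⟩, ih]
  · have h := x.additive ⟨A, hA⟩ ⟨B, hB⟩ hAB
    rw [ihA, ihB, y.additive ⟨A, hA⟩ ⟨B, hB⟩ hAB] at h
    exact (Option.some.inj h).symm
  · have hx := x.sup_cont (fun n => ⟨f n, hfm n⟩) fun n => hf n.le_succ
    have hy := y.sup_cont (fun n => ⟨f n, hfm n⟩) fun n => hf n.le_succ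
    simp only [ih] at hx
    exact le_antisymm (hx.2 _ hy.1) (hy.2 _ hx.1)

/-- The elements `x((-∞,u))` for `u < t` have supremum `x((-∞,t))`. -/
theorem isSup_Iio (t : ℝ) :
    EA.IsSup ((fun u => x.toFun (bIio u)) '' Set.Iio t) (x.toFun (bIio t)) := by
  refine ⟨by rintro _ ⟨u, hu, rfl⟩; exact x.le_of_subset (Set.Iio_subset_Iio (le_of_lt hu)),
    fun b hb => ?_⟩
  obtain ⟨u, hu, hut, hlim⟩ := exists_seq_strictMono_tendsto t
  have h := x.sup_cont (fun n => bIio (u n)) fun n => Set.Iio_subset_Iio (hu.monotone n.le_succ)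
  have hU : bIio t = ⟨⋃ n, (bIio (u n)).1, .iUnion fun n => (bIio (u n)).2⟩ := by
    refine Subtype.ext (Set.Subset.antisymm (fun r hr => ?_)
      (Set.iUnion_subset fun n => Set.Iio_subset_Iio (hut n).le))
    exact Set.mem_iUnion.mpr (hlim.eventually (lt_mem_nhds hr)).exists
  rw [hU]
  exact h.2 b (by rintro _ ⟨n, rfl⟩; exact hb _ ⟨u n, hut n, rfl⟩)

variable {x}

theorem Bounded.exists_Iio_eq (hx : x.Bounded) :
    ∃ l u, (∀ t ≤ l, x.toFun (bIio t) = EA.zero) ∧ ∀ t ≥ u, x.toFun (bIio t) = EA.one := by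
  obtain ⟨C, hC, h1⟩ := hx
  obtain ⟨l, hl⟩ := hC.bddBelow
  obtain ⟨u, hu⟩ := hC.bddAbove
  refine ⟨l, u + 1, fun t ht => ?_, fun t ht => ?_⟩
  · have h := x.additive (bIio t) ⟨C, hC.measurableSet⟩
      (Set.disjoint_left.mpr fun r hr hrC => (hr.trans_le ht).not_ge (hl hrC))
    rw [h1] at h
    exact EA.pos_one _ _ h
  · have h : C ⊆ Set.Iio t := fun r hr => ((hu hr).trans_lt (lt_add_one u)).trans_le ht
    exact eq_one_of_one_le (h1 ▸ x.le_of_subset (A := ⟨C, hC.measurableSet⟩) (B := bIio t) h)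

theorem bounded_of_Iio_eq {l u : ℝ} (hl : x.toFun (bIio l) = EA.zero)
    (hu : x.toFun (bIio u) = EA.one) : x.Bounded := by
  refine ⟨Set.Icc l u, isCompact_Icc, ?_⟩
  have h : Set.Iio u ⊆ Set.Iio l ∪ Set.Icc l u :=
    fun r hr => (lt_or_ge r l).imp id fun h => ⟨h, le_of_lt hr⟩
  have h₁ := eq_one_of_one_le (hu ▸ x.le_of_subset (A := bIio u)
    (B := ⟨Set.Iio l ∪ Set.Icc l u, measurableSet_Iio.union measurableSet_Icc⟩) h)
  have h₂ := x.additive (bIio l) ⟨Set.Icc l u, measurableSet_Icc⟩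
    (Set.disjoint_left.mpr fun r hr hr' => (lt_of_lt_of_le hr hr'.1).false)
  rw [hl, EA.comm, add_zero] at h₂
  exact (Option.some.inj h₂).trans h₁

theorem Bounded.spectralResolution (hx : x.Bounded) :
    SpectralResolution EA fun t => x.toFun (bIio t) := by
  obtain ⟨l, u, hl, hu⟩ := hx.exists_Iio_eq
  exact ⟨fun t s h => x.le_of_subset (Set.Iio_subset_Iio h.le),
    ⟨fun _ _ => EA.zero_le _, fun b hb => hl l (_root_.le_refl l) ▸ hb _ ⟨l, rfl⟩⟩,
    ⟨fun _ _ => EA.le_one _, fun b hb => hu u (_root_.le_refl u) ▸ hb _ ⟨u, rfl⟩⟩,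
    x.isSup_Iio⟩

end Observable

/-- for a family of bounded observables with a bounded upper bound,
`x(t) := ⋁_{u<t} ⋀_α x_α((-∞,u))` is a spectral resolution determining a unique
bounded observable, which is the least upper bound in the Olson order. -/
theorem stmt13 {E : Type*} {A : Type*} [Nonempty A]
    (EA : EffectAlgebra E) (hE : EA.CompleteEA)
    (x_ : A → Observable EA) (hb : ∀ α, (x_ α).Bounded)
    (y : Observable EA) (hy : y.Bounded) (hup : ∀ α, (x_ α).OlsonLe y) :
    ∃ g : ℝ → E,
      (∀ u : ℝ, EA.IsInf (Set.range fun α => (x_ α).toFun (bIio u)) (g u)) ∧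
      ∃! z : Observable EA,
        (∀ t : ℝ, EA.IsSup (g '' Set.Iio t) (z.toFun (bIio t))) ∧
        SpectralResolution EA (fun t => z.toFun (bIio t)) ∧
        z.Bounded ∧
        Observable.IsOlsonSup (Set.range x_) z := by
  let := EA.completeLattice hE
  have : EA.InducesOrder := ⟨Iff.rfl⟩
  obtain ⟨α₀⟩ := ‹Nonempty A›
  let g : ℝ → E := fun u => sInf (Set.range fun α => (x_ α).toFun (bIio u))
  have hg u : IsGLB (Set.range fun α => (x_ α).toFun (bIio u)) (g u) := isGLB_sInf _
  have hg_mono : Monotone g := fun s t hst => (hg t).2 <| by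
    rintro _ ⟨α, rfl⟩
    exact ((hg s).1 ⟨α, rfl⟩).trans ((x_ α).le_of_subset (Set.Iio_subset_Iio hst))
  obtain ⟨l, -, hl, -⟩ := (hb α₀).exists_Iio_eq
  obtain ⟨-, u, -, hu⟩ := hy.exists_Iio_eq
  have hg_bot t (ht : t ≤ l) : g t = ⊥ := by
    rw [← le_bot_iff, ← EA.zero_eq_bot, ← hl t ht]
    exact (hg t).1 ⟨α₀, rfl⟩
  have hg_top t (ht : u ≤ t) : g t = ⊤ := by
    rw [← top_le_iff, ← EA.one_eq_top, ← hu t ht]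
    exact (hg t).2 (by rintro _ ⟨α, rfl⟩; exact hup α t)
  let F : ℝ → E := fun t => sSup (g '' Set.Iio t)
  have hF t : IsLUB (g '' Set.Iio t) (F t) := isLUB_sSup _
  have hF_mono : Monotone F := fun s t hst =>
    (hF s).mono (hF t) (Set.image_mono (Set.Iio_subset_Iio hst))
  have hF_lub t : IsLUB (F '' Set.Iio t) (F t) := by
    refine ⟨by rintro _ ⟨s, hs, rfl⟩; exact hF_mono (le_of_lt hs), fun b hb => (hF t).2 ?_⟩
    rintro _ ⟨s, hs, rfl⟩
    obtain ⟨r, hsr, hrt⟩ := exists_between (Set.mem_Iio.mp hs)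
    exact ((hF r).1 ⟨s, hsr, rfl⟩).trans (hb ⟨r, hrt, rfl⟩)
  have hF_bot t (ht : t ≤ l) : F t = ⊥ := le_bot_iff.mp <| (hF t).2 <| by
    rintro _ ⟨s, hs, rfl⟩
    exact (hg_bot s ((le_of_lt hs).trans ht)).le
  have hF_top t (ht : t ≥ u + 1) : F t = ⊤ := top_le_iff.mp <| by
    rw [← hg_top u le_rfl]
    exact (hF t).1 ⟨u, (lt_add_one u).trans_le ht, rfl⟩
  obtain ⟨z, hz⟩ := EffectAlgebra.exists_observable (EA := EA) hF_mono hF_lub hF_bot hF_top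
  have hzb : z.Bounded := Observable.bounded_of_Iio_eq
    (by rw [hz, hF_bot l le_rfl, EA.zero_eq_bot]) (by rw [hz, hF_top _ le_rfl, EA.one_eq_top])
  have hzs t : EA.IsSup (g '' Set.Iio t) (z.toFun (bIio t)) := by
    rw [EffectAlgebra.isSup_iff_isLUB, hz]
    exact hF t
  refine ⟨g, fun t => EffectAlgebra.isInf_iff_isGLB.mpr (hg t), z,
    ⟨hzs, hzb.spectralResolution, hzb, hzb, ?_, fun w _ hw t => ?_⟩,
    fun z' hz' => Observable.eq_of_Iio fun t => ?_⟩
  · rintro _ ⟨α, rfl⟩ t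
    refine (hzs t).2 _ ?_
    rintro _ ⟨s, hs, rfl⟩
    exact ((hg s).1 ⟨α, rfl⟩).trans ((x_ α).le_of_subset (Set.Iio_subset_Iio (le_of_lt hs)))
  · refine (w.isSup_Iio t).2 _ ?_
    rintro _ ⟨s, hs, rfl⟩
    refine le_trans ((hg s).2 ?_) ((hzs t).1 _ ⟨s, hs, rfl⟩)
    rintro _ ⟨α, rfl⟩
    exact hw _ ⟨α, rfl⟩ s
  · exact (EffectAlgebra.isSup_iff_isLUB.mp (hz'.1 t)).unique
      (EffectAlgebra.isSup_iff_isLUB.mp (hzs t))
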